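/- arXiv:1902.08719 — 2 statements merged into one kernel-verified Lean document; each statement's English description precedes it below -/
import Mathlib

section
/- Let K be a field and (R,E) a connected ring with enough idempotents such that R is a K-algebra. Suppose there is a local valuation ν on (R,E) such that ν(x) = 0 if and only if x lies in the K-linear span of E and x ≠ 0. Then R is semiprimitive, i.e., the Jacobson radical of R is the zero ideal. -/
/-- `I` is a left ideal of the (not necessarily unital) ring `R`, encoded as a set. -/
def IsLeftIdealSet (R : Type) [NonUnitalRing R] (I : Set R) : Prop :=
  0 ∈ I ∧ (∀ x ∈ I, ∀ y ∈ I, x + y ∈ I) ∧ (∀ x ∈ I, -x ∈ I) ∧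
    (∀ (a : R), ∀ x ∈ I, a * x ∈ I)

/-- `I` is a right ideal of the (not necessarily unital) ring `R`, encoded as a set. -/
def IsRightIdealSet (R : Type) [NonUnitalRing R] (I : Set R) : Prop :=
  0 ∈ I ∧ (∀ x ∈ I, ∀ y ∈ I, x + y ∈ I) ∧ (∀ x ∈ I, -x ∈ I) ∧
    (∀ (a : R), ∀ x ∈ I, x * a ∈ I)

/-- `I` is a two-sided ideal of the (not necessarily unital) ring `R`, encoded as a set. -/
def IsTwoSidedIdealSet (R : Type) [NonUnitalRing R] (I : Set R) : Prop :=
  0 ∈ I ∧ (∀ x ∈ I, ∀ y ∈ I, x + y ∈ I) ∧ (∀ x ∈ I, -x ∈ I) ∧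
    (∀ (a : R), ∀ x ∈ I, a * x ∈ I) ∧ (∀ (a : R), ∀ x ∈ I, x * a ∈ I)

/-- A left ideal `I` of `R` is essential if every left ideal `J` with `I ∩ J = {0}`
is the zero ideal. -/
def IsEssentialLeftIdeal (R : Type) [NonUnitalRing R] (I : Set R) : Prop :=
  ∀ J : Set R, IsLeftIdealSet R J → I ∩ J = {0} → J = {0}

/-- A right ideal `I` of `R` is essential if every right ideal `J` with `I ∩ J = {0}`
is the zero ideal. -/
def IsEssentialRightIdeal (R : Type) [NonUnitalRing R] (I : Set R) : Prop :=
  ∀ J : Set R, IsRightIdealSet R J → I ∩ J = {0} → J = {0}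

/-- `R` is left nonsingular: the left annihilator of `x` is essential only for `x = 0`. -/
def LeftNonsingular (R : Type) [NonUnitalRing R] : Prop :=
  ∀ x : R, IsEssentialLeftIdeal R {y : R | y * x = 0} → x = 0

/-- `R` is right nonsingular: the right annihilator of `x` is essential only for `x = 0`. -/
def RightNonsingular (R : Type) [NonUnitalRing R] : Prop :=
  ∀ x : R, IsEssentialRightIdeal R {y : R | x * y = 0} → x = 0

/-- `(R, E)` is a ring with enough idempotents: `E` is a set of nonzero pairwise
orthogonal idempotents of `R` such that the finite sums of distinct elements of `E`
form a set of local units for `R`. -/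
structure EnoughIdempotents (R : Type) [NonUnitalRing R] (E : Set R) : Prop where
  ne_zero : ∀ e ∈ E, e ≠ 0
  idem : ∀ e ∈ E, e * e = e
  orthogonal : ∀ e ∈ E, ∀ f ∈ E, e ≠ f → e * f = 0
  localUnits : ∀ S : Finset R, ∃ F : Finset R, ↑F ⊆ E ∧
    ∀ x ∈ S, (∑ e ∈ F, e) * x * (∑ e ∈ F, e) = x

/-- `(R, E)` is connected: `eRf ≠ {0}` for all `e, f ∈ E`. -/
def ConnectedIdempotents (R : Type) [NonUnitalRing R] (E : Set R) : Prop :=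
  ∀ e ∈ E, ∀ f ∈ E, ∃ x : R, e * x * f ≠ 0

/-- A local valuation on `(R, E)`: a map `ν : R → ℕ₀ ∪ {−∞}` (modelled as `WithBot ℕ`)
such that (i) `ν x = −∞ ↔ x = 0`, (ii) `ν (x - y) ≤ max (ν x) (ν y)` and
(iii) `ν (x * y) = ν x + ν y` whenever `e ∈ E`, `x ∈ Re` and `y ∈ eR`. -/
def IsLocalValuation (R : Type) [NonUnitalRing R] (E : Set R) (ν : R → WithBot ℕ) : Prop :=
  (∀ x : R, ν x = ⊥ ↔ x = 0) ∧
  (∀ x y : R, ν (x - y) ≤ max (ν x) (ν y)) ∧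
  (∀ e ∈ E, ∀ x y : R, x * e = x → e * y = y → ν (x * y) = ν x + ν y)

/-- An element `x` of a ring is left quasi-regular if there is `y` with `x + y = y * x`. -/
def IsLeftQuasiRegular {R : Type} [NonUnitalRing R] (x : R) : Prop :=
  ∃ y : R, x + y = y * x

/-- `R` is semiprimitive: its Jacobson radical is zero, i.e. every two-sided ideal
consisting of left quasi-regular elements is the zero ideal. -/
def Semiprimitive (R : Type) [NonUnitalRing R] : Prop :=
  ∀ J : Set R, IsTwoSidedIdealSet R J → (∀ x ∈ J, IsLeftQuasiRegular x) → J = {0}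

/-- A nonzero element of a ring with enough idempotents has a nonzero corner `e * x * f`. -/
theorem EnoughIdempotents.exists_mul_mul_ne_zero {R : Type} [NonUnitalRing R] {E : Set R}
    (hE : EnoughIdempotents R E) {x : R} (hx : x ≠ 0) :
    ∃ e ∈ E, ∃ f ∈ E, e * x * f ≠ 0 := by
  obtain ⟨F, hF, hu⟩ := hE.localUnits {x}
  by_contra! h
  refine hx ?_
  rw [← hu x (Finset.mem_singleton_self x), Finset.sum_mul, Finset.sum_mul]
  refine Finset.sum_eq_zero fun e he => ?_
  rw [Finset.mul_sum]
  exact Finset.sum_eq_zero fun f hf => h e (hF he) f (hF hf)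

/-- Multiplying an element of the span of `E` by `e ∈ E` gives a scalar multiple of `e`. -/
theorem EnoughIdempotents.exists_mul_eq_smul {K R : Type} [Field K] [NonUnitalRing R]
    [Module K R] [SMulCommClass K R R] {E : Set R} (hE : EnoughIdempotents R E)
    {e : R} (he : e ∈ E) {x : R} (hx : x ∈ Submodule.span K E) :
    ∃ k : K, e * x = k • e := by
  induction hx using Submodule.span_induction with
  | mem f hf =>
    by_cases h : e = f
    · subst h
      exact ⟨1, by rw [hE.idem e he, one_smul]⟩
    · exact ⟨0, by rw [hE.orthogonal e he f hf h, zero_smul]⟩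
  | zero => exact ⟨0, by simp⟩
  | add x y _ _ hx hy =>
    obtain ⟨k, hk⟩ := hx
    obtain ⟨l, hl⟩ := hy
    exact ⟨k + l, by rw [mul_add, hk, hl, add_smul]⟩
  | smul c x _ hx =>
    obtain ⟨k, hk⟩ := hx
    exact ⟨c * k, by rw [mul_smul_comm, hk, mul_smul]⟩

/-- A product through a corner `e ∈ E` of nonzero elements is nonzero. -/
theorem IsLocalValuation.mul_ne_zero {R : Type} [NonUnitalRing R] {E : Set R}
    {ν : R → WithBot ℕ} (hν : IsLocalValuation R E ν) {e x y : R} (he : e ∈ E)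
    (hxe : x * e = x) (hey : e * y = y) (hx : x ≠ 0) (hy : y ≠ 0) : x * y ≠ 0 := by
  rw [Ne, ← hν.1, hν.2.2 e he x y hxe hey, WithBot.add_eq_bot, hν.1, hν.1]
  tauto

/-- A left quasi-regular element of a corner `e * R * e` has a left quasi-inverse in that
corner, so that `e - a` has a left inverse there. -/
theorem IsLeftQuasiRegular.exists_mul_sub_eq {R : Type} [NonUnitalRing R] {e a : R}
    (h : IsLeftQuasiRegular a) (he : e * e = e) (hea : e * a = a) (hae : a * e = a) :
    ∃ b : R, b * e = b ∧ b * (e - a) = e := by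
  obtain ⟨y, hy⟩ := h
  have hye : y * e = y := by
    have : y = y * a - a := by rw [← hy]; abel
    rw [this, sub_mul, mul_assoc, hae]
  refine ⟨e - e * y, by rw [sub_mul, he, mul_assoc, hye], ?_⟩
  rw [sub_mul, mul_sub, mul_sub, he, hea, mul_assoc, hye, mul_assoc, ← hy, mul_add, hea]
  abel

/-- **Proposition 7.9 (Proposition \ref{proplocval4}).** Let `(R, E)` be a connected ring
with enough idempotents which is a `K`-algebra over a field `K`, and suppose there is a
local valuation `ν` on `(R, E)` with `ν x = 0` iff `x ∈ span K E ∖ {0}`. Then `R` is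
semiprimitive. -/
theorem stmt_4 {K R : Type} [Field K] [NonUnitalRing R] [Module K R]
    [IsScalarTower K R R] [SMulCommClass K R R] (E : Set R)
    (hE : EnoughIdempotents R E) (hconn : ConnectedIdempotents R E)
    (ν : R → WithBot ℕ) (hν : IsLocalValuation R E ν)
    (hν0 : ∀ x : R, ν x = 0 ↔ (x ∈ Submodule.span K E ∧ x ≠ 0)) :
    Semiprimitive R := by
  intro J ⟨hJ0, _, _, hJl, hJr⟩ hJ
  refine Set.eq_singleton_iff_unique_mem.2 ⟨hJ0, fun x hx => ?_⟩
  by_contra hx0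
  obtain ⟨e, he, f, hf, hexf⟩ := hE.exists_mul_mul_ne_zero hx0
  obtain ⟨z, hz⟩ := hconn f hf e he
  have hee := hE.idem e he
  have hff := hE.idem f hf
  obtain ⟨a, ha⟩ : ∃ a, a = e * x * f * (f * z * e) := ⟨_, rfl⟩
  have ha0 : a ≠ 0 := by
    rw [ha]
    exact hν.mul_ne_zero hf (by rw [mul_assoc, hff]) (by rw [← mul_assoc, ← mul_assoc, hff])
      hexf hz
  have haJ : a ∈ J := ha ▸ hJr _ _ (hJr _ _ (hJl _ _ hx))
  have hea : e * a = a := by simp only [ha, ← mul_assoc, hee]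
  have hae : a * e = a := by simp only [ha, mul_assoc, hee]
  obtain ⟨b, hbe, hb⟩ := (hJ a haJ).exists_mul_sub_eq hee hea hae
  have heSpan : e ∈ Submodule.span K E := Submodule.subset_span he
  have hsub : ν (e - a) = 0 := by
    have h := hν.2.2 e he b (e - a) hbe (by rw [mul_sub, hee, hea])
    rw [hb, (hν0 e).2 ⟨heSpan, hE.ne_zero e he⟩] at h
    obtain ⟨m, n, _, hn, hmn⟩ := WithBot.add_eq_coe.1 (h.symm.trans WithBot.coe_zero.symm)
    rw [← hn, Nat.eq_zero_of_add_eq_zero_left hmn, WithBot.coe_zero]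
  have haSpan : a ∈ Submodule.span K E := by
    simpa using Submodule.sub_mem _ heSpan ((hν0 _).1 hsub).1
  obtain ⟨k, hk⟩ := hE.exists_mul_eq_smul he haSpan
  rw [hea] at hk
  have hk0 : k ≠ 0 := by
    rintro rfl
    exact ha0 (by rw [hk, zero_smul])
  have heJ : e ∈ J := by
    have h := hJl (k⁻¹ • e) a haJ
    rwa [hk, smul_mul_assoc, mul_smul_comm, hee, inv_smul_smul₀ hk0] at h
  obtain ⟨c, _, hc⟩ := (hJ e heJ).exists_mul_sub_eq hee hee hee
  exact hE.ne_zero e he (by rw [← hc, sub_self, mul_zero])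
end

section
/- Let H be a hypergraph satisfying Condition (LV) and K a field. Then L_K(H) is nonsingular (both left and right nonsingular). -/
open scoped Classical

/-- The generators of the Leavitt path algebra of a hypergraph `H = (H0, H1, s, r)`:
a vertex generator `v` for every `v ∈ H0`, and generators `h_{ij}` (`edge`) and
`h_{ij}^*` (`ghost`) for every hyperedge `h ∈ H1`, `1 ≤ i ≤ |s(h)|`, `1 ≤ j ≤ |r(h)|`.
The multisets `s(h)` and `r(h)` are given as (enumerated) lists over `H0`. -/
inductive HGen (H0 H1 : Type) (s r : H1 → List H0) : Type
  | vertex (v : H0) : HGen H0 H1 s r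
  | edge (h : H1) (i : Fin (s h).length) (j : Fin (r h).length) : HGen H0 H1 s r
  | ghost (h : H1) (i : Fin (s h).length) (j : Fin (r h).length) : HGen H0 H1 s r

namespace HLPA

variable (K : Type) [Field K] (H0 H1 : Type) (s r : H1 → List H0)

/-- The defining relations (i)-(iv) of the Leavitt path algebra of a hypergraph,
imposed on the free algebra on the generators. -/
inductive Rel : FreeAlgebra K (HGen H0 H1 s r) → FreeAlgebra K (HGen H0 H1 s r) → Prop
  | vtx (u v : H0) :
      Rel (FreeAlgebra.ι K (HGen.vertex u : HGen H0 H1 s r) * FreeAlgebra.ι K (HGen.vertex v))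
        (if u = v then FreeAlgebra.ι K (HGen.vertex u : HGen H0 H1 s r) else 0)
  | src_edge (h : H1) (i : Fin (s h).length) (j : Fin (r h).length) :
      Rel (FreeAlgebra.ι K (HGen.vertex ((s h).get i) : HGen H0 H1 s r) *
            FreeAlgebra.ι K (HGen.edge h i j))
        (FreeAlgebra.ι K (HGen.edge h i j))
  | edge_rng (h : H1) (i : Fin (s h).length) (j : Fin (r h).length) :
      Rel (FreeAlgebra.ι K (HGen.edge h i j : HGen H0 H1 s r) *
            FreeAlgebra.ι K (HGen.vertex ((r h).get j)))
        (FreeAlgebra.ι K (HGen.edge h i j))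
  | rng_ghost (h : H1) (i : Fin (s h).length) (j : Fin (r h).length) :
      Rel (FreeAlgebra.ι K (HGen.vertex ((r h).get j) : HGen H0 H1 s r) *
            FreeAlgebra.ι K (HGen.ghost h i j))
        (FreeAlgebra.ι K (HGen.ghost h i j))
  | ghost_src (h : H1) (i : Fin (s h).length) (j : Fin (r h).length) :
      Rel (FreeAlgebra.ι K (HGen.ghost h i j : HGen H0 H1 s r) *
            FreeAlgebra.ι K (HGen.vertex ((s h).get i)))
        (FreeAlgebra.ι K (HGen.ghost h i j))
  | cuntz1 (h : H1) (i i' : Fin (s h).length) :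
      Rel (∑ k : Fin (r h).length,
            FreeAlgebra.ι K (HGen.edge h i k : HGen H0 H1 s r) *
              FreeAlgebra.ι K (HGen.ghost h i' k))
        (if i = i' then FreeAlgebra.ι K (HGen.vertex ((s h).get i) : HGen H0 H1 s r) else 0)
  | cuntz2 (h : H1) (j j' : Fin (r h).length) :
      Rel (∑ k : Fin (s h).length,
            FreeAlgebra.ι K (HGen.ghost h k j : HGen H0 H1 s r) *
              FreeAlgebra.ι K (HGen.edge h k j'))
        (if j = j' then FreeAlgebra.ι K (HGen.vertex ((r h).get j) : HGen H0 H1 s r) else 0)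

/-- The universal unital algebra on the generators subject to the relations (i)-(iv);
it is the unitalization of the Leavitt path algebra of the hypergraph. -/
abbrev Ambient : Type := RingQuot (Rel K H0 H1 s r)

/-- The image of a generator in the ambient algebra. -/
noncomputable def amb (g : HGen H0 H1 s r) : Ambient K H0 H1 s r :=
  RingQuot.mkAlgHom K (Rel K H0 H1 s r) (FreeAlgebra.ι K g)

/-- The Leavitt path algebra of the hypergraph `(H0, H1, s, r)`, realized as the
non-unital subalgebra generated by the generators inside the universal unital algebra
on the generators subject to the relations (i)-(iv). (This is the algebra presented,
in the category of not necessarily unital `K`-algebras, by said generators and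
relations.) -/
noncomputable def LPAsub : NonUnitalSubalgebra K (Ambient K H0 H1 s r) :=
  NonUnitalAlgebra.adjoin K (Set.range (amb K H0 H1 s r))

/-- The Leavitt path algebra `L_K(H)` of the hypergraph `H = (H0, H1, s, r)`. -/
abbrev LPA : Type := ↥(LPAsub K H0 H1 s r)

variable {H0 H1 s r}

/-- A generator, as an element of the Leavitt path algebra. -/
noncomputable def genL (g : HGen H0 H1 s r) : LPA K H0 H1 s r :=
  ⟨amb K H0 H1 s r g, NonUnitalAlgebra.subset_adjoin K (Set.mem_range_self g)⟩

/-- The vertex generator `v ∈ H0` as an element of the Leavitt path algebra. -/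
noncomputable def vgen (v : H0) : LPA K H0 H1 s r := genL K (HGen.vertex v)

/-- The generator `h_{ij}` as an element of the Leavitt path algebra. -/
noncomputable def egen (h : H1) (i : Fin (s h).length) (j : Fin (r h).length) :
    LPA K H0 H1 s r := genL K (HGen.edge h i j)

/-- The generator `h_{ij}^*` as an element of the Leavitt path algebra. -/
noncomputable def ggen (h : H1) (i : Fin (s h).length) (j : Fin (r h).length) :
    LPA K H0 H1 s r := genL K (HGen.ghost h i j)

end HLPA

namespace HLPA

variable (K : Type) [Field K] (H0 H1 : Type) (s r : H1 → List H0)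

noncomputable instance instLPANonUnitalRing : NonUnitalRing (LPA K H0 H1 s r) :=
  NonUnitalSubalgebra.toNonUnitalRing (LPAsub K H0 H1 s r)

noncomputable instance instLPAAddCommGroup : AddCommGroup (LPA K H0 H1 s r) :=
  (instLPANonUnitalRing K H0 H1 s r).toAddCommGroup

noncomputable instance instLPAModule : Module K (LPA K H0 H1 s r) :=
  (LPAsub K H0 H1 s r).instModule

end HLPA

namespace HLPA

section NormalForms

variable {H0 H1 : Type}

/-- The enumerated source (`true`) or range (`false`) of a hyperedge. -/
def side (s r : H1 → List H0) (h : H1) : Bool → List H0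
  | true => s h
  | false => r h

/-- A uniform encoding of the generators `h_{ij}` (`dir = true`, `row = i`, `col = j`) and
`h_{ij}^*` (`dir = false`, `row = j`, `col = i`), with indices starting from `0`. -/
@[ext]
structure Letter (s r : H1 → List H0) where
  /-- the underlying hyperedge -/
  hyp : H1
  /-- `true` for a generator `h_{ij}`, `false` for a generator `h_{ij}^*` -/
  dir : Bool
  /-- index of the vertex at which the letter starts -/
  row : ℕ
  /-- index of the vertex at which the letter ends -/
  col : ℕ

variable {s r : H1 → List H0}

/-- The vertex at which a letter starts. -/
def Letter.src (a : Letter s r) : Option H0 := (side s r a.hyp a.dir)[a.row]?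

/-- The vertex at which a letter ends. -/
def Letter.tgt (a : Letter s r) : Option H0 := (side s r a.hyp (!a.dir))[a.col]?

/-- The indices of a letter are in the permitted range. -/
def Letter.Valid (a : Letter s r) : Prop :=
  a.row < (side s r a.hyp a.dir).length ∧ a.col < (side s r a.hyp (!a.dir)).length

/-- The letter with its column index replaced. -/
def Letter.setCol (a : Letter s r) (k : ℕ) : Letter s r := ⟨a.hyp, a.dir, a.row, k⟩

/-- The letter with its row index replaced. -/
def Letter.setRow (a : Letter s r) (k : ℕ) : Letter s r := ⟨a.hyp, a.dir, k, a.col⟩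

/-- `a b` is of the form `h_{ik} h_{jk}^*` or `h_{ki}^* h_{kj}`. -/
def Matching (a b : Letter s r) : Prop :=
  b.hyp = a.hyp ∧ b.dir = !a.dir ∧ a.col = b.row

/-- `a b` is one of the words `h_{i0} h_{j0}^*` or `h_{0i}^* h_{0j}`, which get rewritten. -/
def Red (a b : Letter s r) : Prop := Matching a b ∧ b.row = 0

/-- The start vertex of a path ending in `v`. -/
def start (v : H0) : List (Letter s r) → Option H0
  | [] => some v
  | a :: _ => a.src

/-- Prepending `a` to the word creates a reducible subword. -/
def RedHead (a : Letter s r) : List (Letter s r) → Prop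
  | [] => False
  | b :: _ => Red a b

/-- Normal words: paths ending in `v` without reducible subwords. -/
def NF (v : H0) : List (Letter s r) → Prop
  | [] => True
  | a :: l => a.Valid ∧ a.tgt = start v l ∧ ¬ RedHead a l ∧ NF v l

theorem Matching.tgt_eq {a b : Letter s r} (h : Matching a b) : a.tgt = b.src := by
  obtain ⟨h1, h2, h3⟩ := h
  simp [Letter.tgt, Letter.src, h1, h2, h3]

/-- Replacing the column of a letter and the word after it preserves normality. -/
theorem NF.glue {u v : H0} {a c : Letter s r} {q : List (Letter s r)} (w : List (Letter s r))
    (h : NF v (w ++ [a])) (h1 : c.hyp = a.hyp) (h2 : c.dir = a.dir) (h3 : c.row = a.row)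
    (hc : NF u (c :: q)) : NF u (w ++ c :: q) := by
  induction w with
  | nil => exact hc
  | cons e w ih =>
    obtain ⟨e1, e2, e3, e4⟩ := h
    refine ⟨e1, ?_, ?_, ih e4⟩
    · rw [e2]
      cases w <;> simp [start, Letter.src, h1, h2, h3]
    · cases w with
      | nil => simpa [RedHead, Red, Matching, h1, h2, h3] using e3
      | cons f w => exact e3

end NormalForms

section NormalModule

variable (K : Type) [Field K] {H0 H1 : Type} {s r : H1 → List H0} (v : H0)

variable (s r) in
/-- The vector space of formal combinations of normal words ending in `v`. -/
abbrev NMod : Type := {l : List (Letter s r) // NF v l} →₀ K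

/-- A word, as an element of `NMod`; it is `0` unless the word is normal. -/
noncomputable def bas (l : List (Letter s r)) : NMod K s r v :=
  if h : NF v l then Finsupp.single ⟨l, h⟩ 1 else 0

/-- The coefficient of a word. -/
noncomputable def cf (l : List (Letter s r)) : NMod K s r v →ₗ[K] K :=
  if h : NF v l then Finsupp.lapply ⟨l, h⟩ else 0

variable {K v}

theorem bas_of_not {l : List (Letter s r)} (h : ¬ NF v l) : bas K v l = 0 := dif_neg h

theorem cf_of_not {l : List (Letter s r)} (h : ¬ NF v l) : cf K v l = 0 := dif_neg h

theorem cf_bas (l l' : List (Letter s r)) :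
    cf K v l (bas K v l') = if l = l' ∧ NF v l' then 1 else 0 := by
  by_cases h : NF v l <;> by_cases h' : NF v l'
  · simp [cf, bas, h, h', Finsupp.single_apply, eq_comm]
  · simp [bas_of_not, h']
  · rw [cf_of_not h, if_neg]
    · rfl
    · rintro ⟨rfl, h2⟩
      exact h h2
  · simp [bas_of_not, h']

theorem NMod.hom_ext {M : Type*} [AddCommMonoid M] [Module K M] {f g : NMod K s r v →ₗ[K] M}
    (h : ∀ l, NF v l → f (bas K v l) = g (bas K v l)) : f = g := by
  refine Finsupp.lhom_ext' fun l => LinearMap.ext_ring ?_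
  have := h l.1 l.2
  simpa [bas, l.2] using this

theorem NMod.exists_cf_ne_zero {m : NMod K s r v} (hm : m ≠ 0) :
    ∃ l, NF v l ∧ cf K v l m ≠ 0 ∧ ∀ l', cf K v l' m ≠ 0 → l'.length ≤ l.length := by
  obtain ⟨l, hl, hmax⟩ := m.support.exists_max_image (fun l => l.1.length)
    (Finsupp.support_nonempty_iff.2 hm)
  refine ⟨l.1, l.2, ?_, fun l' hl' => ?_⟩
  · simpa [cf, l.2] using hl
  · by_cases h : NF v l'
    · exact hmax ⟨l', h⟩ (by simpa [cf, h] using hl')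
    · simp [cf_of_not h] at hl'

variable (K v)

/-- The product of a letter with a normal word, in normal form. -/
noncomputable def letterMul (a : Letter s r) : List (Letter s r) → NMod K s r v
  | [] => bas K v [a]
  | b :: l =>
    if Red a b then
      (if a.row = b.col then bas K v l else 0) -
        ∑ k ∈ Finset.Ico 1 (side s r a.hyp (!a.dir)).length,
          bas K v (a.setCol k :: b.setRow k :: l)
    else bas K v (a :: b :: l)

/-- Left multiplication by a letter. -/
noncomputable def letterAct (a : Letter s r) : Module.End K (NMod K s r v) :=
  Finsupp.linearCombination K (fun l : {l : List (Letter s r) // NF v l} => letterMul K v a l.1)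

/-- Left multiplication by a vertex. -/
noncomputable def vertexAct (u : H0) : Module.End K (NMod K s r v) :=
  Finsupp.linearCombination K (fun l : {l : List (Letter s r) // NF v l} =>
    if start v l.1 = some u then bas K v l.1 else 0)

variable {K v}

theorem letterAct_bas (a : Letter s r) {l : List (Letter s r)} (h : NF v l) :
    letterAct K v a (bas K v l) = letterMul K v a l := by
  simp [letterAct, bas, h]

theorem vertexAct_bas (u : H0) {l : List (Letter s r)} (h : NF v l) :
    vertexAct K v u (bas K v l) = if start v l = some u then bas K v l else 0 := by
  simp [vertexAct, bas, h]

theorem letterMul_of_not_red {a : Letter s r} {l : List (Letter s r)} (h : ¬ RedHead a l) :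
    letterMul K v a l = bas K v (a :: l) := by
  cases l with
  | nil => rfl
  | cons b l => exact if_neg h

theorem letterAct_bas_of_NF {a : Letter s r} {l : List (Letter s r)} (h : NF v (a :: l)) :
    letterAct K v a (bas K v l) = bas K v (a :: l) := by
  rw [letterAct_bas a h.2.2.2, letterMul_of_not_red h.2.2.1]

theorem letterMul_of_tgt_ne {a : Letter s r} {l : List (Letter s r)} (h : a.tgt ≠ start v l) :
    letterMul K v a l = 0 := by
  rw [letterMul_of_not_red, bas_of_not]
  · exact fun h' => h h'.2.1
  · intro hr
    cases l with
    | nil => exact hr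
    | cons b l => exact h (Matching.tgt_eq hr.1)

theorem sum_letterAct_bas (h : H1) (b : Bool) (i j : ℕ) (l : List (Letter s r))
    (hn : 0 < (side s r h (!b)).length)
    (hl : ∀ k < (side s r h (!b)).length, NF v (⟨h, !b, k, j⟩ :: l)) :
    ∑ k ∈ Finset.range (side s r h (!b)).length,
      letterAct K v ⟨h, b, i, k⟩ (bas K v (⟨h, !b, k, j⟩ :: l)) =
        if i = j then bas K v l else 0 := by
  rw [Finset.range_eq_Ico, Finset.sum_eq_sum_Ico_succ_bot hn, letterAct_bas _ (hl 0 hn),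
    letterMul, if_pos ⟨⟨rfl, rfl, rfl⟩, rfl⟩, sub_add, sub_eq_self, sub_eq_zero]
  refine Finset.sum_congr rfl fun k hk => ?_
  rw [Finset.mem_Ico] at hk
  rw [letterAct_bas _ (hl k hk.2), letterMul_of_not_red]
  · rfl
  · intro hr
    have := hr.2
    simp only at this
    omega

/-- The Cuntz relations hold on `NMod`. -/
theorem sum_letterAct_mul (hpos : ∀ h b, 0 < (side s r h b).length) (h : H1) (b : Bool) (i j : ℕ)
    (hi : i < (side s r h b).length) (hj : j < (side s r h b).length) :
    ∑ k ∈ Finset.range (side s r h (!b)).length,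
      letterAct K v (⟨h, b, i, k⟩ : Letter s r) * letterAct K v (⟨h, !b, k, j⟩ : Letter s r) =
        if i = j then vertexAct K v (side s r h b)[i] else 0 := by
  refine NMod.hom_ext fun l hl => ?_
  have hR : (if i = j then vertexAct K v (side s r h b)[i] else 0) (bas K v l) =
      if i = j then (if start v l = some (side s r h b)[j] then bas K v l else 0) else 0 := by
    by_cases h1 : i = j
    · subst h1
      rw [if_pos rfl, if_pos rfl, vertexAct_bas _ hl]
    · rw [if_neg h1, if_neg h1, LinearMap.zero_apply]
  rw [hR]
  simp only [LinearMap.sum_apply, Module.End.mul_apply, letterAct_bas _ hl]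
  by_cases hst : start v l = some (side s r h b)[j]
  swap
  · rw [if_neg hst, ite_self]
    refine Finset.sum_eq_zero fun k _ => ?_
    rw [letterMul_of_tgt_ne, map_zero]
    simp only [Letter.tgt, Bool.not_not, List.getElem?_eq_getElem hj]
    exact fun h' => hst h'.symm
  rw [if_pos hst]
  have htgt : ∀ k, (⟨h, !b, k, j⟩ : Letter s r).tgt = start v l := fun k => by
    rw [hst]; simp [Letter.tgt, List.getElem?_eq_getElem hj]
  by_cases hred : RedHead (⟨h, !b, 0, j⟩ : Letter s r) l
  swap
  · have hred' : ∀ k, ¬ RedHead (⟨h, !b, k, j⟩ : Letter s r) l := by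
      intro k hk
      apply hred
      cases l <;> exact hk
    simp only [letterMul_of_not_red (hred' _)]
    exact sum_letterAct_bas h b i j l (hpos _ _) fun k hk =>
      ⟨⟨hk, by simpa using hj⟩, htgt k, hred' k, hl⟩
  cases l with
  | nil => exact hred.elim
  | cons c l =>
    obtain ⟨c1, c2, c3, c4⟩ := c
    obtain ⟨⟨e1, e2, e3⟩, e4⟩ := hred
    simp only [Bool.not_not] at e1 e2 e3 e4
    subst e1 e2 e4 e3
    have hred' : ∀ k, Red (⟨c1, !c2, k, 0⟩ : Letter s r) ⟨c1, c2, 0, c4⟩ := fun k =>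
      ⟨⟨rfl, (Bool.not_not _).symm, rfl⟩, rfl⟩
    have hNF : ∀ m, m ∈ Finset.Ico 1 (side s r c1 c2).length →
        ∀ k < (side s r c1 (!c2)).length,
        NF v ((⟨c1, !c2, k, m⟩ : Letter s r) :: ⟨c1, c2, m, c4⟩ :: l) := by
      intro m hm k hk
      rw [Finset.mem_Ico] at hm
      refine ⟨⟨hk, by simpa using hm.2⟩, Matching.tgt_eq ⟨rfl, (Bool.not_not _).symm, rfl⟩, ?_,
        ⟨hm.2, hl.1.2⟩, hl.2.1, ?_, hl.2.2.2⟩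
      · intro hr
        have := hr.2
        simp only at this
        omega
      · intro hr
        apply hl.2.2.1
        cases l <;> exact hr
    have hq : c4 < (side s r c1 (!c2)).length := hl.1.2
    have hNFi : i < (side s r c1 c2).length → NF v ((⟨c1, c2, i, c4⟩ : Letter s r) :: l) := by
      intro hi
      refine ⟨⟨hi, hq⟩, hl.2.1, ?_, hl.2.2.2⟩
      intro hr
      apply hl.2.2.1
      cases l <;> exact hr
    simp only [letterMul, if_pos (hred' _), map_sub, map_sum, Finset.sum_sub_distrib, Bool.not_not,
      Letter.setCol, Letter.setRow]
    rw [Finset.sum_comm]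
    rw [Finset.sum_congr rfl fun m hm => sum_letterAct_bas c1 c2 i m _ (hpos _ _) (hNF m hm)]
    rw [Finset.sum_eq_single_of_mem c4 (Finset.mem_range.2 hq), if_pos rfl,
      letterAct_bas_of_NF (hNFi hi)]
    · rw [Finset.sum_ite_eq]
      by_cases h0 : i = 0
      · subst h0; simp
      · rw [if_pos, if_neg h0, sub_self]
        exact Finset.mem_Ico.2 ⟨by omega, hi⟩
    · intro k _ hk
      rw [if_neg hk, map_zero]

end NormalModule

section Products

variable {K : Type} [Field K] {H0 H1 : Type} {s r : H1 → List H0} {u v : H0}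

/-- The coefficients of `a m` at words with at least two letters. -/
theorem cf_letterAct (a : Letter s r) {c d : Letter s r} {t : List (Letter s r)}
    (h : NF v (c :: d :: t)) (m : NMod K s r v) :
    cf K v (c :: d :: t) (letterAct K v a m) =
      (if a = c then cf K v (d :: t) m else 0) -
        (if Matching c d ∧ a = c.setCol 0 then cf K v (d.setRow 0 :: t) m else 0) +
        (if a.col = 0 then cf K v (⟨a.hyp, !a.dir, 0, a.row⟩ :: c :: d :: t) m else 0) := by
  have key : (cf K v (c :: d :: t)).comp (letterAct K v a) =
      (if a = c then cf K v (d :: t) else 0) -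
        (if Matching c d ∧ a = c.setCol 0 then cf K v (d.setRow 0 :: t) else 0) +
        (if a.col = 0 then cf K v (⟨a.hyp, !a.dir, 0, a.row⟩ :: c :: d :: t) else 0) := by
    refine NMod.hom_ext fun l hl => ?_
    have hcd : ¬ Red c d := h.2.2.1
    have e1 : ((if a = c then cf K v (d :: t) else 0) : NMod K s r v →ₗ[K] K) (bas K v l) =
        if a = c ∧ d :: t = l then 1 else 0 := by
      by_cases h1 : a = c <;> simp [h1, cf_bas, hl]
    have e2 : ((if Matching c d ∧ a = c.setCol 0 then cf K v (d.setRow 0 :: t) else 0) :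
        NMod K s r v →ₗ[K] K) (bas K v l) =
        if (Matching c d ∧ a = c.setCol 0) ∧ d.setRow 0 :: t = l then 1 else 0 := by
      by_cases h1 : Matching c d ∧ a = c.setCol 0 <;> simp [h1, cf_bas, hl]
    have e3 : ((if a.col = 0 then cf K v (⟨a.hyp, !a.dir, 0, a.row⟩ :: c :: d :: t) else 0) :
        NMod K s r v →ₗ[K] K) (bas K v l) =
        if a.col = 0 ∧ ⟨a.hyp, !a.dir, 0, a.row⟩ :: c :: d :: t = l then 1 else 0 := by
      by_cases h1 : a.col = 0 <;> simp [h1, cf_bas, hl]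
    rw [LinearMap.add_apply, LinearMap.sub_apply, e1, e2, e3, LinearMap.comp_apply,
      letterAct_bas _ hl]
    by_cases hred : RedHead a l
    · cases l with
      | nil => exact hred.elim
      | cons b l =>
        have hred' : Red a b := hred
        rw [letterMul, if_pos hred', map_sub, map_sum]
        rw [if_neg (c := a = c ∧ _), zero_sub, neg_add_eq_sub]
        · congr 1
          · have : (a.col = 0 ∧ (⟨a.hyp, !a.dir, 0, a.row⟩ : Letter s r) :: c :: d :: t = b :: l) ↔
                (a.row = b.col ∧ c :: d :: t = l) := by
              obtain ⟨⟨h1, h2, h3⟩, h4⟩ := hred'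
              rw [List.cons.injEq, Letter.ext_iff]
              simp only [h1, h2, h3, h4]
              tauto
            by_cases h1 : a.row = b.col
            · rw [if_pos h1, cf_bas]
              exact if_congr (by rw [this]; simp [h1, hl.2.2.2]) rfl rfl
            · rw [if_neg h1, map_zero, if_neg (fun h2 => h1 (this.1 h2).1)]
          · have hk : ∀ k ∈ Finset.Ico 1 (side s r a.hyp (!a.dir)).length,
                cf K v (c :: d :: t) (bas K v (a.setCol k :: b.setRow k :: l)) =
                  if c.col = k then
                    (if (Matching c d ∧ a = c.setCol 0) ∧ d.setRow 0 :: t = b :: l then 1 else 0)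
                  else 0 := by
              intro k hk
              have hiff : (c :: d :: t = a.setCol k :: b.setRow k :: l) ↔
                  (c.col = k ∧ (Matching c d ∧ a = c.setCol 0) ∧ d.setRow 0 :: t = b :: l) := by
                obtain ⟨⟨h1, h2, h3⟩, h4⟩ := hred'
                simp only [List.cons.injEq, Letter.ext_iff, Letter.setCol, Letter.setRow, Matching]
                constructor
                · rintro ⟨⟨f1, f2, f3, f4⟩, ⟨f5, f6, f7, f8⟩, f9⟩
                  simp_all
                · rintro ⟨f0, ⟨⟨f1, f2, f3⟩, ⟨f4, f5, f6, f7⟩⟩, ⟨f8, f9, f10, f11⟩, f12⟩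
                  refine ⟨⟨f4.symm, f5.symm, f6.symm, f0⟩, ⟨f8, f9, ?_, f11⟩, f12⟩
                  rw [← f3, f0]
              rw [cf_bas, ← ite_and]
              exact if_congr ⟨fun h1 => hiff.1 h1.1, fun h1 => ⟨hiff.2 h1, hiff.2 h1 ▸ h⟩⟩ rfl rfl
            rw [Finset.sum_congr rfl hk, Finset.sum_ite_eq]
            split_ifs with h1 h2 h2
            · rfl
            · rfl
            · exfalso
              apply h1
              obtain ⟨⟨g1, g2⟩, g3⟩ := h2
              rw [Finset.mem_Ico]
              refine ⟨?_, ?_⟩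
              · rw [Nat.one_le_iff_ne_zero]
                exact fun h0 => hcd ⟨g1, g1.2.2 ▸ h0⟩
              · rw [g2]; exact h.1.2
            · rfl
        · rintro ⟨rfl, h2⟩
          rw [List.cons.injEq] at h2
          exact hcd (h2.1 ▸ hred')
    · rw [letterMul_of_not_red hred, cf_bas, if_neg (c := _ ∧ d.setRow 0 :: t = l),
        if_neg (c := a.col = 0 ∧ _), sub_zero, add_zero]
      · by_cases h1 : a = c ∧ d :: t = l
        · obtain ⟨rfl, rfl⟩ := h1
          simp [h]
        · rw [if_neg h1, if_neg]
          rintro ⟨h2, -⟩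
          rw [List.cons.injEq] at h2
          exact h1 ⟨h2.1.symm, h2.2⟩
      · rintro ⟨h1, rfl⟩
        exact hred ⟨⟨rfl, rfl, h1⟩, rfl⟩
      · rintro ⟨⟨⟨h1, h2, h3⟩, rfl⟩, rfl⟩
        exact hred ⟨⟨h1, h2, rfl⟩, rfl⟩
  have := LinearMap.congr_fun key m
  rw [LinearMap.comp_apply] at this
  rw [this]
  split_ifs <;> simp

/-- All words occurring in `m` have length at most `n`. -/
def DegLE (n : ℕ) (m : NMod K s r v) : Prop := ∀ l, n < l.length → cf K v l m = 0

theorem DegLE.letterAct {n : ℕ} {m : NMod K s r v} (hm : DegLE n m) (a : Letter s r) :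
    DegLE (n + 1) (letterAct K v a m) := by
  intro l hl
  by_cases h : NF v l
  swap
  · rw [cf_of_not h]; rfl
  match l, hl, h with
  | [_], hl, _ => simp at hl
  | c :: d :: t, hl, h =>
    simp only [List.length_cons] at hl
    rw [cf_letterAct a h, hm, hm, hm] <;> simp <;> omega

variable (K v) in
/-- Left multiplication by a word. -/
noncomputable def wordAct (p : List (Letter s r)) : Module.End K (NMod K s r v) :=
  (p.map (letterAct K v)).prod

theorem wordAct_cons_apply (a : Letter s r) (p : List (Letter s r)) (m : NMod K s r v) :
    wordAct K v (a :: p) m = letterAct K v a (wordAct K v p m) := by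
  simp [wordAct]

theorem DegLE.wordAct {n : ℕ} {m : NMod K s r v} (hm : DegLE n m) (p : List (Letter s r)) :
    DegLE (p.length + n) (wordAct K v p m) := by
  induction p with
  | nil => simpa [HLPA.wordAct] using hm
  | cons a p ih =>
    rw [wordAct_cons_apply]
    have := ih.letterAct a
    rwa [show p.length + n + 1 = (a :: p).length + n by simp; omega] at this

/-- The leading coefficients of `p m` for a normal word `p`. -/
theorem cf_wordAct {n : ℕ} {m : NMod K s r v} (hm : DegLE n m) {p : List (Letter s r)}
    (hp : NF u p) (w : List (Letter s r)) (c d : Letter s r) (w' : List (Letter s r))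
    (hw : w.length + 1 = p.length) (hw' : w'.length + 1 = n) (h : NF v (w ++ c :: d :: w')) :
    cf K v (w ++ c :: d :: w') (wordAct K v p m) =
      (if p = w ++ [c] then cf K v (d :: w') m else 0) -
        (if Matching c d ∧ p = w ++ [c.setCol 0] then cf K v (d.setRow 0 :: w') m else 0) := by
  induction p generalizing w c with
  | nil => simp at hw
  | cons a p ih =>
    have hdeg := hm.wordAct p
    rw [wordAct_cons_apply]
    match w, hw, h with
    | [], hw, h =>
      obtain rfl : p = [] := List.length_eq_zero_iff.1 (by simpa using hw.symm)
      rw [List.nil_append, cf_letterAct a h, hdeg (_ :: _ :: _ :: _) (by simp; omega)]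
      simp [wordAct]
    | [e], hw, h =>
      simp only [List.length_cons, List.length_nil] at hw
      have h2 : Matching e c ∧ a = e.setCol 0 →
          cf K v (c.setRow 0 :: d :: w') (wordAct K v p m) = 0 := by
        rintro ⟨⟨g1, g2, g3⟩, rfl⟩
        by_cases hN : NF v (c.setRow 0 :: d :: w')
        swap
        · rw [cf_of_not hN]; rfl
        rw [← List.nil_append (_ :: d :: w'), ih hp.2.2.2 [] _ (by simp; omega) hN,
          if_neg, if_neg, sub_zero]
        · rintro ⟨-, rfl⟩
          exact hp.2.2.1 ⟨⟨g1, g2, rfl⟩, rfl⟩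
        · rintro rfl
          exact hp.2.2.1 ⟨⟨g1, g2, rfl⟩, rfl⟩
      rw [List.singleton_append, cf_letterAct a h, hdeg (_ :: _ :: _ :: _) (by simp; omega),
        ite_eq_right_iff.2 h2, ite_self, add_zero, sub_zero, ← List.nil_append (c :: d :: w'),
        ih hp.2.2.2 [] _ (by simp; omega) h.2.2.2]
      by_cases hae : a = e <;> simp [hae]
    | e :: f :: w, hw, h =>
      simp only [List.length_cons] at hw
      have h2 : Matching e f ∧ a = e.setCol 0 →
          cf K v (f.setRow 0 :: (w ++ c :: d :: w')) (wordAct K v p m) = 0 := by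
        rintro ⟨⟨g1, g2, g3⟩, rfl⟩
        by_cases hN : NF v (f.setRow 0 :: (w ++ c :: d :: w'))
        swap
        · rw [cf_of_not hN]; rfl
        rw [← List.cons_append, ih hp.2.2.2 (f.setRow 0 :: w) _ (by simp; omega) hN,
          if_neg, if_neg, sub_zero]
        · rintro ⟨-, rfl⟩
          exact hp.2.2.1 ⟨⟨g1, g2, rfl⟩, rfl⟩
        · rintro rfl
          exact hp.2.2.1 ⟨⟨g1, g2, rfl⟩, rfl⟩
      have h' : NF v (e :: f :: (w ++ c :: d :: w')) := h
      rw [List.cons_append, List.cons_append, cf_letterAct a h',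
        hdeg (_ :: _ :: _ :: _) (by simp; omega),
        ite_eq_right_iff.2 h2, ite_self, add_zero, sub_zero, ← List.cons_append,
        ih hp.2.2.2 (f :: w) _ (by simp; omega) h.2.2.2]
      by_cases hae : a = e <;> simp [hae]

variable (K v) in
/-- Left multiplication by a combination of normal words. -/
noncomputable def polyAct (X : NMod K s r u) : Module.End K (NMod K s r v) :=
  Finsupp.linearCombination K (fun p : {l : List (Letter s r) // NF u l} => wordAct K v p.1) X

theorem cf_eq_sum (l : List (Letter s r)) (m : NMod K s r v) :
    cf K v l m = ∑ p ∈ m.support, if p.1 = l then m p else 0 := by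
  by_cases h : NF v l
  · have : ∀ p ∈ m.support, (if p.1 = l then m p else 0) = if p = ⟨l, h⟩ then m p else 0 :=
      fun p _ => by simp only [Subtype.ext_iff]
    rw [Finset.sum_congr rfl this, Finset.sum_ite_eq']
    simp only [cf, h, dif_pos, Finsupp.lapply_apply, Finsupp.mem_support_iff]
    split_ifs with h1
    · rfl
    · exact not_not.1 h1
  · rw [cf_of_not h, LinearMap.zero_apply, Finset.sum_eq_zero]
    rintro p -
    rw [if_neg]
    rintro rfl
    exact h p.2

/-- The leading coefficients of a product. -/
theorem cf_polyAct {n : ℕ} {X : NMod K s r u} {Y : NMod K s r v} (hY : DegLE n Y)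
    (w : List (Letter s r)) (c d : Letter s r) (w' : List (Letter s r))
    (hX : DegLE (w.length + 1) X) (hw' : w'.length + 1 = n) (h : NF v (w ++ c :: d :: w')) :
    cf K v (w ++ c :: d :: w') (polyAct K v X Y) =
      cf K u (w ++ [c]) X * cf K v (d :: w') Y -
        (if Matching c d then cf K u (w ++ [c.setCol 0]) X * cf K v (d.setRow 0 :: w') Y
          else 0) := by
  have hterm : ∀ p ∈ X.support, X p * cf K v (w ++ c :: d :: w') (wordAct K v p.1 Y) =
      (if p.1 = w ++ [c] then X p else 0) * cf K v (d :: w') Y -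
        (if p.1 = w ++ [c.setCol 0] then X p else 0) *
          (if Matching c d then cf K v (d.setRow 0 :: w') Y else 0) := by
    intro p hp
    have hle : p.1.length ≤ w.length + 1 := by
      by_contra hlt
      have := hX p.1 (not_le.1 hlt)
      rw [cf, dif_pos p.2] at this
      exact Finsupp.mem_support_iff.1 hp this
    rcases hle.eq_or_lt with heq | hlt
    · rw [cf_wordAct hY p.2 w c d w' heq.symm hw' h]
      by_cases h1 : Matching c d <;> simp [h1, mul_sub]
    · rw [hY.wordAct p.1 _ (by simp; omega), if_neg, if_neg]
      · simp
      · intro h1; simp [h1] at hlt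
      · intro h1; simp [h1] at hlt
  have : cf K v (w ++ c :: d :: w') (polyAct K v X Y) =
      ∑ p ∈ X.support, X p * cf K v (w ++ c :: d :: w') (wordAct K v p.1 Y) := by
    simp [polyAct, Finsupp.linearCombination_apply, Finsupp.sum, LinearMap.sum_apply]
  rw [this, Finset.sum_congr rfl hterm, Finset.sum_sub_distrib, ← Finset.sum_mul,
    ← Finset.sum_mul, ← cf_eq_sum, ← cf_eq_sum, mul_ite, mul_zero]

theorem NF.tgt_getLast {w : List (Letter s r)} {a : Letter s r} (h : NF v (w ++ [a])) :
    a.Valid ∧ a.tgt = some v := by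
  induction w with
  | nil => exact ⟨h.1, h.2.1⟩
  | cons b w ih => exact ih h.2.2.2

/-- Products of nonzero elements whose leading words are nonempty are nonzero. -/
theorem polyAct_ne_zero (hLV : ∀ h b, 2 ≤ (side s r h b).length)
    {X : NMod K s r u} {Y : NMod K s r v}
    (hYs : ∀ l, cf K v l Y ≠ 0 → start v l = some u)
    {w w' : List (Letter s r)} {a b : Letter s r}
    (hX : DegLE (w.length + 1) X) (hY : DegLE (w'.length + 1) Y)
    (ha : cf K u (w ++ [a]) X ≠ 0) (hb : cf K v (b :: w') Y ≠ 0) :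
    polyAct K v X Y ≠ 0 := by
  intro h0
  have NFX : ∀ {l}, cf K u l X ≠ 0 → NF u l := fun {l} h => by
    by_contra hn; rw [cf_of_not hn] at h; exact h rfl
  have NFY : ∀ {l}, cf K v l Y ≠ 0 → NF v l := fun {l} h => by
    by_contra hn; rw [cf_of_not hn] at h; exact h rfl
  have hmatch : ∀ {c d : Letter s r}, cf K u (w ++ [c]) X ≠ 0 → cf K v (d :: w') Y ≠ 0 →
      Matching c d := by
    intro c d hc hd
    by_contra hn
    have hNF : NF v (w ++ c :: d :: w') :=
      (NFX hc).glue w rfl rfl rfl ⟨(NFX hc).tgt_getLast.1,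
        (NFX hc).tgt_getLast.2.trans (hYs _ hd).symm, fun hr => hn hr.1, NFY hd⟩
    have := cf_polyAct hY w c d w' hX rfl hNF
    rw [h0, map_zero, if_neg hn, sub_zero] at this
    exact mul_ne_zero hc hd this.symm
  have hab := hmatch ha hb
  by_cases hk : a.col = 0
  · have hcol : (1 : ℕ) < (side s r (a.setCol 1).hyp (!(a.setCol 1).dir)).length := hLV _ _
    have hm : Matching (a.setCol 1) (b.setRow 1) := ⟨hab.1, hab.2.1, rfl⟩
    have hNFb := NFY hb
    have hNF : NF v (w ++ a.setCol 1 :: b.setRow 1 :: w') := by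
      refine (NFX ha).glue w rfl rfl rfl ⟨⟨(NFX ha).tgt_getLast.1.1, hcol⟩, Matching.tgt_eq hm, ?_,
        ⟨?_, hNFb.1.2⟩, hNFb.2.1, ?_, hNFb.2.2.2⟩
      · exact fun hr => one_ne_zero hr.2
      · have := hLV b.hyp b.dir
        exact this
      · have := hNFb.2.2.1
        cases w' <;> exact this
    have h1 := cf_polyAct hY w _ _ w' hX rfl hNF
    have ea : (a.setCol 1).setCol 0 = a := by ext <;> simp [Letter.setCol, hk]
    have eb : (b.setRow 1).setRow 0 = b := by ext <;> simp [Letter.setRow, ← hab.2.2, hk]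
    rw [h0, map_zero, if_pos hm, ea, eb, eq_comm, sub_eq_zero] at h1
    have hX1 : cf K u (w ++ [a.setCol 1]) X ≠ 0 := by
      intro h2
      rw [h2, zero_mul] at h1
      exact mul_ne_zero ha hb h1.symm
    have := (hmatch hX1 hb).2.2
    rw [← hab.2.2, hk] at this
    exact one_ne_zero this
  · have hNF : NF v (w ++ a :: b :: w') :=
      (NFX ha).glue w rfl rfl rfl ⟨(NFX ha).tgt_getLast.1, Matching.tgt_eq hab,
        fun hr => hk (hab.2.2.trans hr.2), NFY hb⟩
    have h1 := cf_polyAct hY w _ _ w' hX rfl hNF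
    rw [h0, map_zero, if_pos hab, eq_comm, sub_eq_zero] at h1
    have hX1 : cf K u (w ++ [a.setCol 0]) X ≠ 0 := by
      intro h2
      rw [h2, zero_mul] at h1
      exact mul_ne_zero ha hb h1
    have := (hmatch hX1 hb).2.2
    exact hk (hab.2.2.trans this.symm)

end Products

section Representation

variable {K : Type} [Field K] {H0 H1 : Type} {s r : H1 → List H0} {v : H0}

theorem vertexAct_bas_of_start {u : H0} {l : List (Letter s r)} (h : start v l = some u) :
    vertexAct K v u (bas K v l) = bas K v l := by
  by_cases hl : NF v l
  · rw [vertexAct_bas u hl, if_pos h]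
  · rw [bas_of_not hl, map_zero]

theorem cf_vertexAct (u : H0) (l : List (Letter s r)) (m : NMod K s r v) :
    cf K v l (vertexAct K v u m) = if start v l = some u then cf K v l m else 0 := by
  have key : (cf K v l).comp (vertexAct K v u) =
      if start v l = some u then cf K v l else 0 := by
    refine NMod.hom_ext fun l' hl' => ?_
    rw [LinearMap.comp_apply, vertexAct_bas u hl']
    by_cases h : l = l'
    · subst h
      split_ifs <;> simp
    · have h0 : cf K v l (bas K v l') = 0 := by rw [cf_bas, if_neg fun h' => h h'.1]
      split_ifs <;> simp [h0]
  have := LinearMap.congr_fun key m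
  rw [LinearMap.comp_apply] at this
  rw [this]
  split_ifs <;> simp

theorem NMod.ext_cf {m m' : NMod K s r v} (h : ∀ l, NF v l → cf K v l m = cf K v l m') :
    m = m' := by
  ext l
  have := h l.1 l.2
  simp only [cf, dif_pos l.2] at this
  exact this

theorem vertexAct_mul_vertexAct (u u' : H0) :
    vertexAct K v u * vertexAct K v u' =
      if u = u' then (vertexAct K v u : Module.End K (NMod K s r v)) else 0 := by
  refine LinearMap.ext fun m => NMod.ext_cf fun l _ => ?_
  rw [Module.End.mul_apply, cf_vertexAct, cf_vertexAct]
  by_cases h : u = u'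
  · subst h
    rw [if_pos rfl, cf_vertexAct]
    split_ifs <;> rfl
  · rw [if_neg h, LinearMap.zero_apply, map_zero]
    split_ifs with h1 h2
    · exact absurd (Option.some.inj (h1.symm.trans h2)) h
    · rfl
    · rfl

theorem vertexAct_mul_letterAct {u : H0} {a : Letter s r} (ha : a.src = some u) :
    vertexAct K v u * letterAct K v a = letterAct K v a := by
  refine NMod.hom_ext fun l hl => ?_
  rw [Module.End.mul_apply, letterAct_bas _ hl]
  by_cases hred : RedHead a l
  · cases l with
    | nil => exact hred.elim
    | cons b l =>
      have hred' : Red a b := hred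
      rw [letterMul, if_pos hred', map_sub, map_sum]
      congr 1
      · split_ifs with h
        · refine vertexAct_bas_of_start (hl.2.1.symm.trans (Eq.trans ?_ ha))
          simp [Letter.tgt, Letter.src, hred'.1.1, hred'.1.2.1, h]
        · exact map_zero _
      · exact Finset.sum_congr rfl fun k _ => vertexAct_bas_of_start ha
  · rw [letterMul_of_not_red hred]
    exact vertexAct_bas_of_start ha

theorem letterAct_mul_vertexAct {u : H0} {a : Letter s r} (ha : a.tgt = some u) :
    letterAct K v a * vertexAct K v u = letterAct K v a := by
  refine NMod.hom_ext fun l hl => ?_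
  rw [Module.End.mul_apply, vertexAct_bas u hl]
  split_ifs with h
  · rfl
  · rw [map_zero, letterAct_bas _ hl, letterMul_of_tgt_ne]
    rw [ha]
    exact fun h' => h h'.symm

variable (K v) in
/-- The action of the generators on `NMod`. -/
noncomputable def genAct : HGen H0 H1 s r → Module.End K (NMod K s r v)
  | .vertex u => vertexAct K v u
  | .edge h i j => letterAct K v ⟨h, true, i, j⟩
  | .ghost h i j => letterAct K v ⟨h, false, j, i⟩

theorem genAct_rel (hpos : ∀ h b, 0 < (side s r h b).length)
    ⦃x y : FreeAlgebra K (HGen H0 H1 s r)⦄ (h : Rel K H0 H1 s r x y) :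
    FreeAlgebra.lift K (genAct K v) x = FreeAlgebra.lift K (genAct K v) y := by
  cases h with
  | vtx u u' =>
    rw [map_mul, FreeAlgebra.lift_ι_apply, FreeAlgebra.lift_ι_apply]
    refine (vertexAct_mul_vertexAct u u').trans ?_
    split_ifs
    · rw [FreeAlgebra.lift_ι_apply]; rfl
    · rw [map_zero]
  | src_edge h i j =>
    rw [map_mul, FreeAlgebra.lift_ι_apply, FreeAlgebra.lift_ι_apply]
    exact vertexAct_mul_letterAct (by simp [Letter.src, side])
  | edge_rng h i j =>
    rw [map_mul, FreeAlgebra.lift_ι_apply, FreeAlgebra.lift_ι_apply]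
    exact letterAct_mul_vertexAct (by simp [Letter.tgt, side])
  | rng_ghost h i j =>
    rw [map_mul, FreeAlgebra.lift_ι_apply, FreeAlgebra.lift_ι_apply]
    exact vertexAct_mul_letterAct (by simp [Letter.src, side])
  | ghost_src h i j =>
    rw [map_mul, FreeAlgebra.lift_ι_apply, FreeAlgebra.lift_ι_apply]
    exact letterAct_mul_vertexAct (by simp [Letter.tgt, side])
  | cuntz1 h i i' =>
    have := sum_letterAct_mul (K := K) (v := v) hpos h true i i' i.2 i'.2
    rw [Finset.sum_range] at this
    simp only [map_sum, map_mul, FreeAlgebra.lift_ι_apply]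
    refine Eq.trans this ?_
    by_cases hi : i = i'
    · rw [if_pos hi, if_pos (congrArg Fin.val hi), FreeAlgebra.lift_ι_apply]; rfl
    · rw [if_neg hi, if_neg (fun h' => hi (Fin.ext h')), map_zero]
  | cuntz2 h j j' =>
    have := sum_letterAct_mul (K := K) (v := v) hpos h false j j' j.2 j'.2
    rw [Finset.sum_range] at this
    simp only [map_sum, map_mul, FreeAlgebra.lift_ι_apply]
    refine Eq.trans this ?_
    by_cases hj : j = j'
    · rw [if_pos hj, if_pos (congrArg Fin.val hj), FreeAlgebra.lift_ι_apply]; rfl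
    · rw [if_neg hj, if_neg (fun h' => hj (Fin.ext h')), map_zero]

variable (K v) in
/-- The representation of the ambient algebra on combinations of normal words ending in `v`. -/
noncomputable def rep (hpos : ∀ h b, 0 < (side s r h b).length) :
    Ambient K H0 H1 s r →ₐ[K] Module.End K (NMod K s r v) :=
  RingQuot.liftAlgHom K ⟨FreeAlgebra.lift K (genAct K v), genAct_rel hpos⟩

theorem rep_amb (hpos : ∀ h b, 0 < (side s r h b).length) (g : HGen H0 H1 s r) :
    rep K v hpos (amb K H0 H1 s r g) = genAct K v g := by
  rw [rep, amb, RingQuot.liftAlgHom_mkAlgHom_apply, FreeAlgebra.lift_ι_apply]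

end Representation

section Evaluation

variable (K : Type) [Field K] {H0 H1 : Type} (s r : H1 → List H0)

/-- A vertex in the ambient algebra. -/
noncomputable def vertexVal (u : H0) : Ambient K H0 H1 s r := amb K H0 H1 s r (.vertex u)

variable {s r}

/-- The value of a letter in the ambient algebra; it is `0` unless the letter is valid. -/
noncomputable def letterVal : Letter s r → Ambient K H0 H1 s r
  | ⟨h, true, i, j⟩ =>
    if hv : i < (s h).length ∧ j < (r h).length then
      amb K H0 H1 s r (.edge h ⟨i, hv.1⟩ ⟨j, hv.2⟩) else 0
  | ⟨h, false, i, j⟩ =>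
    if hv : i < (r h).length ∧ j < (s h).length then
      amb K H0 H1 s r (.ghost h ⟨j, hv.2⟩ ⟨i, hv.1⟩) else 0

/-- The value of a word in the ambient algebra. -/
noncomputable def wordVal (p : List (Letter s r)) : Ambient K H0 H1 s r :=
  (p.map (letterVal K)).prod

/-- Evaluation of combinations of normal words in the ambient algebra. -/
noncomputable def eval (v : H0) : NMod K s r v →ₗ[K] Ambient K H0 H1 s r :=
  Finsupp.linearCombination K
    (fun l : {l : List (Letter s r) // NF v l} => wordVal K l.1 * vertexVal K s r v)

variable {K} {v : H0}

theorem vertexVal_mul_vertexVal (u u' : H0) :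
    vertexVal K s r u * vertexVal K s r u' = if u = u' then vertexVal K s r u else 0 := by
  have := RingQuot.mkAlgHom_rel K (Rel.vtx (K := K) (s := s) (r := r) u u')
  rw [map_mul] at this
  refine Eq.trans this ?_
  split_ifs
  · rfl
  · rw [map_zero]

theorem vertexVal_mul_self (u : H0) :
    vertexVal K s r u * vertexVal K s r u = vertexVal K s r u := by
  rw [vertexVal_mul_vertexVal, if_pos rfl]

theorem vertexVal_mul_letterVal {u : H0} {a : Letter s r} (ha : a.src = some u) :
    vertexVal K s r u * letterVal K a = letterVal K a := by
  obtain ⟨h, _ | _, i, j⟩ := a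
  · rw [letterVal]
    split_ifs with hv
    · have := RingQuot.mkAlgHom_rel K
        (Rel.rng_ghost (K := K) (s := s) (r := r) h ⟨j, hv.2⟩ ⟨i, hv.1⟩)
      rw [map_mul] at this
      simp only [Letter.src, side, List.getElem?_eq_getElem hv.1, Option.some.injEq] at ha
      subst ha
      exact this
    · exact mul_zero _
  · rw [letterVal]
    split_ifs with hv
    · have := RingQuot.mkAlgHom_rel K
        (Rel.src_edge (K := K) (s := s) (r := r) h ⟨i, hv.1⟩ ⟨j, hv.2⟩)
      rw [map_mul] at this
      simp only [Letter.src, side, List.getElem?_eq_getElem hv.1, Option.some.injEq] at ha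
      subst ha
      exact this
    · exact mul_zero _

theorem letterVal_mul_vertexVal {u : H0} {a : Letter s r} (ha : a.tgt = some u) :
    letterVal K a * vertexVal K s r u = letterVal K a := by
  obtain ⟨h, _ | _, i, j⟩ := a
  · rw [letterVal]
    split_ifs with hv
    · have := RingQuot.mkAlgHom_rel K
        (Rel.ghost_src (K := K) (s := s) (r := r) h ⟨j, hv.2⟩ ⟨i, hv.1⟩)
      rw [map_mul] at this
      simp only [Letter.tgt, side, Bool.not_false, List.getElem?_eq_getElem hv.2,
        Option.some.injEq] at ha
      subst ha
      exact this
    · exact zero_mul _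
  · rw [letterVal]
    split_ifs with hv
    · have := RingQuot.mkAlgHom_rel K
        (Rel.edge_rng (K := K) (s := s) (r := r) h ⟨i, hv.1⟩ ⟨j, hv.2⟩)
      rw [map_mul] at this
      simp only [Letter.tgt, side, Bool.not_true, List.getElem?_eq_getElem hv.2,
        Option.some.injEq] at ha
      subst ha
      exact this
    · exact zero_mul _

theorem letterVal_edge (h : H1) (i : Fin (s h).length) (j : Fin (r h).length) :
    letterVal K (⟨h, true, i, j⟩ : Letter s r) = amb K H0 H1 s r (.edge h i j) := by
  rw [letterVal, dif_pos ⟨i.2, j.2⟩]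

theorem letterVal_ghost (h : H1) (i : Fin (s h).length) (j : Fin (r h).length) :
    letterVal K (⟨h, false, j, i⟩ : Letter s r) = amb K H0 H1 s r (.ghost h i j) := by
  rw [letterVal, dif_pos ⟨j.2, i.2⟩]

theorem sum_letterVal_mul (h : H1) (b : Bool) (i j : ℕ)
    (hi : i < (side s r h b).length) (hj : j < (side s r h b).length) :
    ∑ k ∈ Finset.range (side s r h (!b)).length,
      letterVal K (⟨h, b, i, k⟩ : Letter s r) * letterVal K (⟨h, !b, k, j⟩ : Letter s r) =
        if i = j then vertexVal K s r (side s r h b)[i] else 0 := by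
  rw [Finset.sum_range]
  cases b with
  | false =>
    have := RingQuot.mkAlgHom_rel K (Rel.cuntz2 (K := K) (s := s) (r := r) h ⟨i, hi⟩ ⟨j, hj⟩)
    simp only [map_sum, map_mul] at this
    refine Eq.trans (Finset.sum_congr rfl fun k _ => ?_) (this.trans ?_)
    · exact congrArg₂ _ (letterVal_ghost h k ⟨i, hi⟩) (letterVal_edge h k ⟨j, hj⟩)
    · by_cases hij : i = j
      · rw [if_pos hij, if_pos (Fin.ext hij)]
        rfl
      · rw [if_neg hij, if_neg fun h' => hij (congrArg Fin.val h')]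
        exact map_zero _
  | true =>
    have := RingQuot.mkAlgHom_rel K (Rel.cuntz1 (K := K) (s := s) (r := r) h ⟨i, hi⟩ ⟨j, hj⟩)
    simp only [map_sum, map_mul] at this
    refine Eq.trans (Finset.sum_congr rfl fun k _ => ?_) (this.trans ?_)
    · exact congrArg₂ _ (letterVal_edge h ⟨i, hi⟩ k) (letterVal_ghost h ⟨j, hj⟩ k)
    · by_cases hij : i = j
      · rw [if_pos hij, if_pos (Fin.ext hij)]
        rfl
      · rw [if_neg hij, if_neg fun h' => hij (congrArg Fin.val h')]
        exact map_zero _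

theorem eval_bas {l : List (Letter s r)} (h : NF v l) :
    eval K v (bas K v l) = wordVal K l * vertexVal K s r v := by
  simp [eval, bas, h]

theorem eval_bas_nil : eval K v (bas K v ([] : List (Letter s r))) = vertexVal K s r v := by
  have h : NF v ([] : List (Letter s r)) := trivial
  rw [eval_bas h, wordVal, List.map_nil, List.prod_nil, one_mul]

theorem wordVal_cons (a : Letter s r) (l : List (Letter s r)) :
    wordVal K (a :: l) = letterVal K a * wordVal K l := by
  simp [wordVal]

theorem NF.exists_start {l : List (Letter s r)} (h : NF v l) : ∃ u, start v l = some u := by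
  cases l with
  | nil => exact ⟨v, rfl⟩
  | cons a l => exact ⟨_, List.getElem?_eq_getElem h.1.1⟩

theorem vertexVal_mul_eval_bas (u : H0) {l : List (Letter s r)} (h : NF v l) :
    vertexVal K s r u * eval K v (bas K v l) =
      if start v l = some u then eval K v (bas K v l) else 0 := by
  obtain ⟨u', hu'⟩ := h.exists_start
  have key : vertexVal K s r u' * eval K v (bas K v l) = eval K v (bas K v l) := by
    rw [eval_bas h]
    cases l with
    | nil =>
      obtain rfl : v = u' := Option.some.inj hu'
      simp [wordVal, vertexVal_mul_self]
    | cons a l =>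
      rw [wordVal_cons, ← mul_assoc, ← mul_assoc, vertexVal_mul_letterVal hu']
  split_ifs with h1
  · obtain rfl : u' = u := Option.some.inj (hu'.symm.trans h1)
    exact key
  · rw [← key, ← mul_assoc, vertexVal_mul_vertexVal, if_neg, zero_mul]
    rintro rfl
    exact h1 hu'

theorem eval_vertexAct (u : H0) (m : NMod K s r v) :
    eval K v (vertexAct K v u m) = vertexVal K s r u * eval K v m := by
  have : (eval K v).comp (vertexAct K v u) =
      (LinearMap.mulLeft K (vertexVal K s r u)).comp (eval K v) := by
    refine NMod.hom_ext fun l hl => ?_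
    rw [LinearMap.comp_apply, LinearMap.comp_apply, LinearMap.mulLeft_apply, vertexAct_bas u hl,
      vertexVal_mul_eval_bas u hl]
    split_ifs <;> simp
  exact LinearMap.congr_fun this m

theorem eval_letterMul (hpos : ∀ h b, 0 < (side s r h b).length) {a : Letter s r} (ha : a.Valid)
    {l : List (Letter s r)} (hl : NF v l) :
    eval K v (letterMul K v a l) = letterVal K a * eval K v (bas K v l) := by
  by_cases ht : a.tgt = start v l
  swap
  · obtain ⟨u, hu⟩ : ∃ u, a.tgt = some u := ⟨_, List.getElem?_eq_getElem ha.2⟩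
    rw [letterMul_of_tgt_ne ht, map_zero, ← letterVal_mul_vertexVal hu, mul_assoc,
      vertexVal_mul_eval_bas u hl, if_neg, mul_zero]
    rw [← hu]
    exact fun h => ht h.symm
  by_cases hred : RedHead a l
  swap
  · have hal : NF v (a :: l) := ⟨ha, ht, hred, hl⟩
    rw [letterMul_of_not_red hred, eval_bas hal, eval_bas hl, wordVal_cons, mul_assoc]
  cases l with
  | nil => exact hred.elim
  | cons b l =>
    obtain ⟨h, d, i, k⟩ := a
    obtain ⟨h', d', k', j⟩ := b
    obtain ⟨⟨e1, e2, e3⟩, e4⟩ := id hred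
    simp only at e1 e2 e3 e4
    subst e1 e2 e4 e3
    have hj : j < (side s r h' d).length := by simpa using hl.1.2
    have hNF : ∀ m ∈ Finset.Ico 1 (side s r h' (!d)).length,
        NF v ((⟨h', d, i, m⟩ : Letter s r) :: ⟨h', !d, m, j⟩ :: l) := by
      intro m hm
      rw [Finset.mem_Ico] at hm
      refine ⟨⟨ha.1, hm.2⟩, Matching.tgt_eq ⟨rfl, rfl, rfl⟩, ?_, ⟨hm.2, hl.1.2⟩, hl.2.1, ?_, hl.2.2.2⟩
      · intro hr
        have := hr.2
        simp only at this
        omega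
      · intro hr
        apply hl.2.2.1
        cases l <;> exact hr
    have hsum := sum_letterVal_mul (K := K) h' d i j ha.1 hj
    rw [Finset.range_eq_Ico, Finset.sum_eq_sum_Ico_succ_bot (hpos _ _), zero_add,
      ← eq_sub_iff_add_eq] at hsum
    have hred' : Red (⟨h', d, i, 0⟩ : Letter s r) ⟨h', !d, 0, j⟩ := hred
    rw [letterMul, if_pos hred', map_sub, map_sum, eval_bas hl, wordVal_cons, ← mul_assoc,
      ← mul_assoc, hsum, sub_mul, sub_mul, Finset.sum_mul, Finset.sum_mul]
    congr 1
    · simp only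
      split_ifs with hij
      · subst hij
        rw [mul_assoc, ← eval_bas hl.2.2.2, vertexVal_mul_eval_bas _ hl.2.2.2, if_pos]
        rw [← hl.2.1]
        simp [Letter.tgt, List.getElem?_eq_getElem hj]
      · rw [map_zero, zero_mul, zero_mul]
    · refine Finset.sum_congr rfl fun m hm => ?_
      refine (eval_bas (hNF m hm)).trans ?_
      rw [wordVal_cons, wordVal_cons, mul_assoc, mul_assoc, mul_assoc, mul_assoc]

theorem eval_letterAct (hpos : ∀ h b, 0 < (side s r h b).length) {a : Letter s r} (ha : a.Valid)
    (m : NMod K s r v) :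
    eval K v (letterAct K v a m) = letterVal K a * eval K v m := by
  have : (eval K v).comp (letterAct K v a) =
      (LinearMap.mulLeft K (letterVal K a)).comp (eval K v) := by
    refine NMod.hom_ext fun l hl => ?_
    rw [LinearMap.comp_apply, LinearMap.comp_apply, LinearMap.mulLeft_apply, letterAct_bas a hl,
      eval_letterMul hpos ha hl]
  exact LinearMap.congr_fun this m

theorem eval_rep (hpos : ∀ h b, 0 < (side s r h b).length) (x : Ambient K H0 H1 s r)
    (m : NMod K s r v) : eval K v (rep K v hpos x m) = x * eval K v m := by
  obtain ⟨f, rfl⟩ := RingQuot.mkAlgHom_surjective K (Rel K H0 H1 s r) x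
  induction f using FreeAlgebra.induction generalizing m with
  | grade0 c =>
    rw [AlgHom.commutes, AlgHom.commutes, Module.algebraMap_end_apply, map_smul,
      Algebra.smul_def]
  | grade1 g =>
    change eval K v (rep K v hpos (amb K H0 H1 s r g) m) = amb K H0 H1 s r g * _
    rw [rep_amb]
    cases g with
    | vertex u => exact eval_vertexAct u m
    | edge h i j =>
      rw [← letterVal_edge]
      exact eval_letterAct hpos ⟨i.2, j.2⟩ m
    | ghost h i j =>
      rw [← letterVal_ghost]
      exact eval_letterAct hpos ⟨j.2, i.2⟩ m
  | mul f g hf hg =>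
    rw [map_mul, map_mul, Module.End.mul_apply, hf, hg, mul_assoc]
  | add f g hf hg =>
    rw [map_add, map_add, LinearMap.add_apply, map_add, hf, hg, add_mul]

theorem rep_letterVal (hpos : ∀ h b, 0 < (side s r h b).length) {a : Letter s r} (ha : a.Valid) :
    rep K v hpos (letterVal K a) = letterAct K v a := by
  obtain ⟨h, _ | _, i, j⟩ := a
  · rw [letterVal, dif_pos (show i < (r h).length ∧ j < (s h).length from ha), rep_amb]; rfl
  · rw [letterVal, dif_pos (show i < (s h).length ∧ j < (r h).length from ha), rep_amb]; rfl

theorem rep_wordVal (hpos : ∀ h b, 0 < (side s r h b).length) {u : H0} {p : List (Letter s r)}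
    (hp : NF u p) : rep K v hpos (wordVal K p) = wordAct K v p := by
  induction p with
  | nil => simp [wordVal, wordAct]
  | cons a p ih =>
    rw [wordVal_cons, map_mul, ih hp.2.2.2, rep_letterVal hpos hp.1]
    simp [wordAct]

theorem rep_vertexVal (hpos : ∀ h b, 0 < (side s r h b).length) (u : H0) :
    rep K v hpos (vertexVal K s r u) = vertexAct K v u := rep_amb hpos _

theorem rep_eval (hpos : ∀ h b, 0 < (side s r h b).length) {u : H0} (X : NMod K s r u) :
    rep K v hpos (eval K u X) = polyAct K v X * vertexAct K v u := by
  simp only [eval, polyAct, Finsupp.linearCombination_apply, Finsupp.sum, map_sum, map_smul,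
    map_mul, rep_vertexVal, Finset.sum_mul, smul_mul_assoc]
  exact Finset.sum_congr rfl fun p _ => by rw [rep_wordVal hpos p.2]

theorem eq_smul_bas_nil {m : NMod K s r v} (h : DegLE 0 m) :
    m = cf K v [] m • bas K v [] := by
  refine NMod.ext_cf fun l _ => ?_
  rw [map_smul, cf_bas]
  cases l with
  | nil => simp [NF]
  | cons a l => rw [h _ (by simp), if_neg (by simp), smul_zero]

/-- The algebra is locally a domain: `x u ≠ 0` and `u y ≠ 0` imply `x u y ≠ 0`. -/
theorem mul_vertexVal_mul_ne_zero (hLV : ∀ h b, 2 ≤ (side s r h b).length) {u : H0}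
    {x y : Ambient K H0 H1 s r} (hx : x * vertexVal K s r u ≠ 0)
    (hy : vertexVal K s r u * y * vertexVal K s r v ≠ 0) :
    x * vertexVal K s r u * y * vertexVal K s r v ≠ 0 := by
  have hpos : ∀ h b, 0 < (side s r h b).length := fun h b => two_pos.trans_le (hLV h b)
  set X : NMod K s r u := rep K u hpos x (bas K u []) with hXdef
  set Y : NMod K s r v := rep K v hpos (vertexVal K s r u * y) (bas K v []) with hYdef
  have hX : eval K u X = x * vertexVal K s r u := by rw [hXdef, eval_rep, eval_bas_nil]
  have hY : eval K v Y = vertexVal K s r u * y * vertexVal K s r v := by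
    rw [hYdef, eval_rep, eval_bas_nil]
  have hX0 : X ≠ 0 := fun h => hx (by rw [← hX, h, map_zero])
  have hY0 : Y ≠ 0 := fun h => hy (by rw [← hY, h, map_zero])
  have hassoc : x * vertexVal K s r u * y * vertexVal K s r v =
      x * vertexVal K s r u * (vertexVal K s r u * y * vertexVal K s r v) := by
    rw [← mul_assoc, ← mul_assoc, mul_assoc x (vertexVal K s r u) (vertexVal K s r u),
      vertexVal_mul_self]
  have hYu : vertexAct K v u Y = Y := by
    rw [hYdef, ← rep_vertexVal hpos, ← Module.End.mul_apply, ← map_mul, ← mul_assoc,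
      vertexVal_mul_self]
  have hYs : ∀ l, cf K v l Y ≠ 0 → start v l = some u := by
    intro l hl
    by_contra h
    rw [← hYu, cf_vertexAct, if_neg h] at hl
    exact hl rfl
  obtain ⟨p, -, hpX, hpmax⟩ := NMod.exists_cf_ne_zero hX0
  obtain ⟨q, -, hqY, hqmax⟩ := NMod.exists_cf_ne_zero hY0
  have hdX : DegLE p.length X := fun l hl => by
    by_contra h
    exact absurd (hpmax l h) (not_le.2 hl)
  have hdY : DegLE q.length Y := fun l hl => by
    by_contra h
    exact absurd (hqmax l h) (not_le.2 hl)
  obtain rfl | ⟨w, a, rfl⟩ := List.eq_nil_or_concat' p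
  · rw [eq_smul_bas_nil hdX, map_smul, eval_bas_nil] at hX
    rw [mul_assoc, mul_assoc, ← mul_assoc, ← hX, smul_mul_assoc, ← mul_assoc]
    exact smul_ne_zero hpX hy
  cases q with
  | nil =>
    obtain rfl : v = u := Option.some.inj (hYs _ hqY)
    rw [eq_smul_bas_nil hdY, map_smul, eval_bas_nil] at hY
    rw [hassoc, ← hY, mul_smul_comm, mul_assoc, vertexVal_mul_self]
    exact smul_ne_zero hqY hx
  | cons b w' =>
    intro h0
    refine polyAct_ne_zero hLV hYs (w := w) (w' := w') (by simpa using hdX) (by simpa using hdY)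
      hpX hqY ?_
    have h1 : rep K v hpos (eval K u X) Y = polyAct K v X Y := by
      rw [rep_eval, Module.End.mul_apply, hYu]
    have h2 : rep K v hpos (vertexVal K s r v) (bas K v []) = bas K v [] := by
      rw [rep_vertexVal]
      exact vertexAct_bas_of_start rfl
    rw [← h1, hX, hYdef, ← h2, ← Module.End.mul_apply, ← Module.End.mul_apply, ← map_mul,
      ← map_mul, mul_assoc (x * vertexVal K s r u), ← hassoc, h0, map_zero, LinearMap.zero_apply]

end Evaluation

section LocalUnits

variable {K : Type} [Field K] {H0 H1 : Type} {s r : H1 → List H0}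

theorem sum_vertexVal_mul {G : Finset H0} {u : H0} (hu : u ∈ G) {x : Ambient K H0 H1 s r}
    (hx : vertexVal K s r u * x = x) : (∑ w ∈ G, vertexVal K s r w) * x = x := by
  rw [Finset.sum_mul, Finset.sum_eq_single_of_mem u hu, hx]
  intro w _ hw
  rw [← hx, ← mul_assoc, vertexVal_mul_vertexVal, if_neg hw, zero_mul]

theorem mul_sum_vertexVal {G : Finset H0} {u : H0} (hu : u ∈ G) {x : Ambient K H0 H1 s r}
    (hx : x * vertexVal K s r u = x) : x * ∑ w ∈ G, vertexVal K s r w = x := by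
  rw [Finset.mul_sum, Finset.sum_eq_single_of_mem u hu, hx]
  intro w _ hw
  rw [← hx, mul_assoc, vertexVal_mul_vertexVal, if_neg hw.symm, mul_zero]

theorem exists_vertex_units (g : HGen H0 H1 s r) :
    ∃ u w, vertexVal K s r u * amb K H0 H1 s r g = amb K H0 H1 s r g ∧
      amb K H0 H1 s r g * vertexVal K s r w = amb K H0 H1 s r g := by
  cases g with
  | vertex u => exact ⟨u, u, vertexVal_mul_self u, vertexVal_mul_self u⟩
  | edge h i j =>
    rw [← letterVal_edge]
    exact ⟨(s h)[i], (r h)[j], vertexVal_mul_letterVal (by simp [Letter.src, side]),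
      letterVal_mul_vertexVal (by simp [Letter.tgt, side])⟩
  | ghost h i j =>
    rw [← letterVal_ghost]
    exact ⟨(r h)[j], (s h)[i], vertexVal_mul_letterVal (by simp [Letter.src, side]),
      letterVal_mul_vertexVal (by simp [Letter.tgt, side])⟩

/-- Finite sums of vertices are local units. -/
theorem exists_local_unit {x : Ambient K H0 H1 s r} (hx : x ∈ LPAsub K H0 H1 s r) :
    ∃ F : Finset H0, ∀ G, F ⊆ G →
      (∑ u ∈ G, vertexVal K s r u) * x = x ∧ x * (∑ u ∈ G, vertexVal K s r u) = x := by
  rw [LPAsub] at hx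
  induction hx using NonUnitalAlgebra.adjoin_induction with
  | mem x hx =>
    obtain ⟨g, rfl⟩ := hx
    obtain ⟨u, w, hu, hw⟩ := exists_vertex_units (K := K) g
    exact ⟨{u, w}, fun G hG => ⟨sum_vertexVal_mul (hG (by simp)) hu,
      mul_sum_vertexVal (hG (by simp)) hw⟩⟩
  | add x y _ _ hx hy =>
    obtain ⟨F, hF⟩ := hx
    obtain ⟨F', hF'⟩ := hy
    refine ⟨F ∪ F', fun G hG => ?_⟩
    have h1 := hF G (Finset.union_subset_left hG)
    have h2 := hF' G (Finset.union_subset_right hG)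
    rw [mul_add, add_mul, h1.1, h1.2, h2.1, h2.2]
    exact ⟨rfl, rfl⟩
  | zero => exact ⟨∅, fun G _ => ⟨mul_zero _, zero_mul _⟩⟩
  | mul x y _ _ hx hy =>
    obtain ⟨F, hF⟩ := hx
    obtain ⟨F', hF'⟩ := hy
    refine ⟨F ∪ F', fun G hG => ?_⟩
    have h1 := hF G (Finset.union_subset_left hG)
    have h2 := hF' G (Finset.union_subset_right hG)
    exact ⟨by rw [← mul_assoc, h1.1], by rw [mul_assoc, h2.2]⟩
  | smul c x _ hx =>
    obtain ⟨F, hF⟩ := hx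
    refine ⟨F, fun G hG => ?_⟩
    rw [mul_smul_comm, smul_mul_assoc, (hF G hG).1, (hF G hG).2]
    exact ⟨rfl, rfl⟩

theorem exists_vertexVal_mul_ne_zero {x : Ambient K H0 H1 s r} (hx : x ∈ LPAsub K H0 H1 s r)
    (h0 : x ≠ 0) : ∃ u, vertexVal K s r u * x ≠ 0 := by
  by_contra! h
  obtain ⟨F, hF⟩ := exists_local_unit hx
  apply h0
  rw [← (hF F subset_rfl).1, Finset.sum_mul, Finset.sum_eq_zero fun u _ => h u]

theorem exists_mul_vertexVal_ne_zero {x : Ambient K H0 H1 s r} (hx : x ∈ LPAsub K H0 H1 s r)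
    (h0 : x ≠ 0) : ∃ u, x * vertexVal K s r u ≠ 0 := by
  by_contra! h
  obtain ⟨F, hF⟩ := exists_local_unit hx
  apply h0
  rw [← (hF F subset_rfl).2, Finset.mul_sum, Finset.sum_eq_zero fun u _ => h u]

theorem coe_vgen (u : H0) :
    ((vgen K u : LPA K H0 H1 s r) : Ambient K H0 H1 s r) = vertexVal K s r u := rfl

theorem vgen_mul_self (u : H0) : (vgen K u * vgen K u : LPA K H0 H1 s r) = vgen K u :=
  Subtype.ext (vertexVal_mul_self u)

theorem leftNonsingular_LPA (hLV : ∀ h b, 2 ≤ (side s r h b).length) :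
    LeftNonsingular (LPA K H0 H1 s r) := by
  intro x hess
  by_contra hx
  have hx' : (x : Ambient K H0 H1 s r) ≠ 0 := fun h => hx (Subtype.ext h)
  obtain ⟨u, hu⟩ := exists_vertexVal_mul_ne_zero x.2 hx'
  obtain ⟨v, hv⟩ := exists_mul_vertexVal_ne_zero (vgen K u * x).2 hu
  have hJ := hess {y | y * vgen K u = y}
    ⟨zero_mul _, fun y hy z hz => by rw [Set.mem_ofPred_eq, add_mul, hy, hz],
      fun y hy => by rw [Set.mem_ofPred_eq, neg_mul, hy],
      fun a y hy => by rw [Set.mem_ofPred_eq, mul_assoc, hy]⟩ ?_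
  · have : vgen K u ∈ ({0} : Set (LPA K H0 H1 s r)) := hJ ▸ vgen_mul_self u
    apply hu
    rw [← coe_vgen, Set.mem_singleton_iff.1 this]
    exact zero_mul _
  · refine Set.eq_singleton_iff_unique_mem.2 ⟨⟨zero_mul _, zero_mul _⟩, ?_⟩
    rintro y ⟨hyx, hyu⟩
    by_contra hy
    have hyu' : (y : Ambient K H0 H1 s r) * vertexVal K s r u = y := congrArg Subtype.val hyu
    have hyx' : (y : Ambient K H0 H1 s r) * x = 0 := congrArg Subtype.val hyx
    refine mul_vertexVal_mul_ne_zero hLV (x := (y : Ambient K H0 H1 s r)) ?_ hv ?_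
    · rw [hyu']
      exact fun h => hy (Subtype.ext h)
    · rw [hyu', hyx', zero_mul]

theorem rightNonsingular_LPA (hLV : ∀ h b, 2 ≤ (side s r h b).length) :
    RightNonsingular (LPA K H0 H1 s r) := by
  intro x hess
  by_contra hx
  have hx' : (x : Ambient K H0 H1 s r) ≠ 0 := fun h => hx (Subtype.ext h)
  obtain ⟨u, hu⟩ := exists_mul_vertexVal_ne_zero x.2 hx'
  have hJ := hess {y | vgen K u * y = y}
    ⟨mul_zero _, fun y hy z hz => by rw [Set.mem_ofPred_eq, mul_add, hy, hz],
      fun y hy => by rw [Set.mem_ofPred_eq, mul_neg, hy],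
      fun a y hy => by rw [Set.mem_ofPred_eq, ← mul_assoc, hy]⟩ ?_
  · have : vgen K u ∈ ({0} : Set (LPA K H0 H1 s r)) := hJ ▸ vgen_mul_self u
    apply hu
    rw [← coe_vgen, Set.mem_singleton_iff.1 this]
    exact mul_zero _
  · refine Set.eq_singleton_iff_unique_mem.2 ⟨⟨mul_zero _, mul_zero _⟩, ?_⟩
    rintro y ⟨hxy, hyu⟩
    by_contra hy
    have hyu' : vertexVal K s r u * (y : Ambient K H0 H1 s r) = y := congrArg Subtype.val hyu
    have hxy' : (x : Ambient K H0 H1 s r) * y = 0 := congrArg Subtype.val hxy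
    obtain ⟨v, hv⟩ := exists_mul_vertexVal_ne_zero y.2 fun h => hy (Subtype.ext h)
    refine mul_vertexVal_mul_ne_zero hLV hu (y := (y : Ambient K H0 H1 s r)) (v := v) ?_ ?_
    · rwa [hyu']
    · rw [mul_assoc (x : Ambient K H0 H1 s r), hyu', hxy', zero_mul]

end LocalUnits

end HLPA

open HLPA in
/-- **Corollary 7.12 (Corollary \ref{corlocval1}).** If the hypergraph `H` satisfies
Condition (LV), then `L_K(H)` is (left and right) nonsingular. -/
theorem stmt_13 (K : Type) [Field K] (H0 H1 : Type) [Nonempty H0]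
    (s r : H1 → List H0) (hs : ∀ h, s h ≠ []) (hr : ∀ h, r h ≠ [])
    (hLV : ∀ h : H1, 2 ≤ (s h).length ∧ 2 ≤ (r h).length) :
    LeftNonsingular (LPA K H0 H1 s r) ∧ RightNonsingular (LPA K H0 H1 s r) := by
  have hLV' : ∀ h b, 2 ≤ (side s r h b).length := by
    rintro h (_ | _)
    · exact (hLV h).2
    · exact (hLV h).1
  exact ⟨leftNonsingular_LPA hLV', rightNonsingular_LPA hLV'⟩
end
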